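/- Let σ be a 4-dimensional full-dimensional strongly convex rational polyhedral cone in N ⊗ ℝ (N free of rank 4) possessing a ray τ₀ such that every facet of σ containing τ₀ is simplicial, and such that the rays of σ other than τ₀ span N ⊗ ℝ. Let f₁,...,f_k be the facets containing τ₀. Then the quotient complex F⁰/F^k of the third Ishida complex, namely 0 → Λ³M_ℝ → ⊕_{v ⊂ ∪f_i} Λ²v^⊥ → ⊕_{e ⊂ ∪f_i} Λ¹e^⊥ → ⊕_{f ∈ {f₁,...,f_k}} ℝ → 0, has term dimensions 4, 3(k+1), 4k, k, hence Euler characteristic 1; since the first map is injective, H²(F⁰/F^k) ≠ 0. -/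

import Mathlib

open Module

/-- A subset of `ℝⁿ` is a rational polyhedral cone if it is the set of nonnegative
combinations of finitely many lattice vectors. -/
def IsRatPolyhedralCone {n : ℕ} (σ : Set (Fin n → ℝ)) : Prop :=
  ∃ S : Finset (Fin n → ℤ),
    σ = {x | ∃ c : (Fin n → ℤ) → ℝ, (∀ s, 0 ≤ c s) ∧
          x = ∑ s ∈ S, c s • (fun i => ((s i : ℝ)))}

/-- A cone is strongly convex if it contains no line. -/
def IsStronglyConvex {n : ℕ} (σ : Set (Fin n → ℝ)) : Prop :=
  ∀ x ∈ σ, -x ∈ σ → x = 0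

/-- `F` is a face of `σ` if it is the zero locus on `σ` of a linear functional
that is nonnegative on `σ`. -/
def IsFaceOf {n : ℕ} (σ F : Set (Fin n → ℝ)) : Prop :=
  ∃ u : (Fin n → ℝ) →ₗ[ℝ] ℝ, (∀ x ∈ σ, 0 ≤ u x) ∧ F = {x | x ∈ σ ∧ u x = 0}

/-- The dimension of a face: the dimension of its linear span. -/
noncomputable def faceDim {n : ℕ} (F : Set (Fin n → ℝ)) : ℕ :=
  Module.finrank ℝ (Submodule.span ℝ F)

theorem test : True := trivial

/-- `Λ^k μ^⊥`, realised as the space of alternating `k`-forms on `ℝⁿ` that vanish whenever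
one of their arguments lies in the linear span of `μ`. -/
noncomputable def Ann {n : ℕ} (μ : Set (Fin n → ℝ)) (k : ℕ) :
    Submodule ℝ ((Fin n → ℝ) [⋀^Fin k]→ₗ[ℝ] ℝ) where
  carrier := {ω | ∀ v : Fin k → (Fin n → ℝ), (∃ i, v i ∈ Submodule.span ℝ μ) → ω v = 0}
  add_mem' := by
    intro a b ha hb v hv
    simp [ha v hv, hb v hv]
  zero_mem' := by
    intro v hv
    rfl
  smul_mem' := by
    intro c a ha v hv
    simp [ha v hv]

/-- A face `F` of `σ` is simplicial if its rays are linearly independent, equivalently if it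
has exactly `dim F` one-dimensional faces. -/
def IsSimplicialFace {n : ℕ} (σ F : Set (Fin n → ℝ)) : Prop :=
  Nat.card {r : Set (Fin n → ℝ) // IsFaceOf σ r ∧ faceDim r = 1 ∧ r ⊆ F} = faceDim F

section ConeFaces

variable {n : ℕ} {σ F G H : Set (Fin n → ℝ)} {T : Finset (Fin n → ℝ)}

lemma IsRatPolyhedralCone.exists_hull (h : IsRatPolyhedralCone σ) :
    ∃ T : Finset (Fin n → ℝ), σ = (PointedCone.hull ℝ (T : Set (Fin n → ℝ)) : Set _) := by
  classical
  obtain ⟨S, rfl⟩ := h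
  refine ⟨S.image fun s i => (s i : ℝ), Set.Subset.antisymm ?_ ?_⟩
  · rintro x ⟨c, hc, rfl⟩
    refine Submodule.sum_mem _ fun s hs => ?_
    exact Submodule.smul_mem _ (⟨c s, hc s⟩ : NNReal)
      (Submodule.subset_span (by simpa using ⟨s, hs, rfl⟩))
  · intro x hx
    refine Submodule.span_induction ?_ ?_ ?_ ?_ hx
    · intro y hy
      obtain ⟨s, hs, rfl⟩ : ∃ s ∈ S, (fun i => (s i : ℝ)) = y := by simpa using hy
      refine ⟨fun t => if t = s then 1 else 0, fun t => by positivity, ?_⟩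
      simp [hs]
    · exact ⟨0, fun _ => le_rfl, by simp⟩
    · rintro _ _ _ _ ⟨c, hc, rfl⟩ ⟨d, hd, rfl⟩
      exact ⟨c + d, fun s => add_nonneg (hc s) (hd s), by
        simp [add_smul, Finset.sum_add_distrib]⟩
    · rintro a _ _ ⟨c, hc, rfl⟩
      refine ⟨fun s => a.1 * c s, fun s => mul_nonneg a.2 (hc s), ?_⟩
      rw [Finset.smul_sum]
      exact Finset.sum_congr rfl fun s _ => smul_smul a.1 (c s) _

lemma IsFaceOf.subset (hF : IsFaceOf σ F) : F ⊆ σ := by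
  obtain ⟨u, -, rfl⟩ := hF
  exact fun x hx => hx.1

lemma IsFaceOf.refl (σ : Set (Fin n → ℝ)) : IsFaceOf σ σ :=
  ⟨0, fun _ _ => le_rfl, by simp⟩

lemma IsFaceOf.inter (hF : IsFaceOf σ F) (hG : IsFaceOf σ G) : IsFaceOf σ (F ∩ G) := by
  obtain ⟨u, hu, rfl⟩ := hF
  obtain ⟨v, hv, rfl⟩ := hG
  refine ⟨u + v, fun x hx => add_nonneg (hu x hx) (hv x hx), ?_⟩
  ext x
  constructor
  · rintro ⟨⟨hx, hux⟩, -, hvx⟩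
    exact ⟨hx, by simp [hux, hvx]⟩
  · rintro ⟨hx, h⟩
    have h1 := hu x hx
    have h2 := hv x hx
    rw [LinearMap.add_apply] at h
    exact ⟨⟨hx, by linarith⟩, hx, by linarith⟩

lemma eq_zero_on_span {u : (Fin n → ℝ) →ₗ[ℝ] ℝ} (hu : ∀ x ∈ F, u x = 0) {x : Fin n → ℝ}
    (hx : x ∈ Submodule.span ℝ F) : u x = 0 :=
  (Submodule.span_le (p := LinearMap.ker u)).2 (fun y hy => hu y hy) hx

lemma IsFaceOf.mem_of_mem_span (hF : IsFaceOf σ F) {x : Fin n → ℝ} (hx : x ∈ σ)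
    (hxF : x ∈ Submodule.span ℝ F) : x ∈ F := by
  obtain ⟨u, -, rfl⟩ := hF
  exact ⟨hx, eq_zero_on_span (fun y hy => hy.2) hxF⟩

lemma faceDim_mono (h : F ⊆ G) : faceDim F ≤ faceDim G :=
  Submodule.finrank_mono (Submodule.span_mono h)

lemma IsFaceOf.eq_of_subset (hF : IsFaceOf σ F) (hG : IsFaceOf σ G) (h : F ⊆ G)
    (hd : faceDim G ≤ faceDim F) : F = G := by
  have hs : Submodule.span ℝ F = Submodule.span ℝ G :=
    Submodule.eq_of_le_of_finrank_le (Submodule.span_mono h) hd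
  refine h.antisymm fun x hx => hF.mem_of_mem_span (hG.subset hx) ?_
  rw [hs]
  exact Submodule.subset_span hx

lemma IsFaceOf.faceDim_lt (hF : IsFaceOf σ F) (hG : IsFaceOf σ G) (h : F ⊆ G) (hne : F ≠ G) :
    faceDim F < faceDim G := by
  by_contra! hd
  exact hne (hF.eq_of_subset hG h hd)

lemma nonneg_of_nonneg_generators (hσ : σ = (PointedCone.hull ℝ (T : Set (Fin n → ℝ)) : Set _))
    {w : (Fin n → ℝ) →ₗ[ℝ] ℝ} (hw : ∀ s ∈ T, 0 ≤ w s) : ∀ x ∈ σ, 0 ≤ w x := by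
  subst hσ
  intro x hx
  refine Submodule.span_induction hw (by simp) (fun x y _ _ hx hy => ?_)
    (fun a x _ hx => ?_) hx
  · rw [map_add]
    exact add_nonneg hx hy
  · have : w (a • x) = a.1 * w x := by
      rw [← smul_eq_mul, ← map_smul]
      rfl
    rw [this]
    exact mul_nonneg a.2 hx

lemma generator_mem (hσ : σ = (PointedCone.hull ℝ (T : Set (Fin n → ℝ)) : Set _))
    {s : Fin n → ℝ} (hs : s ∈ T) : s ∈ σ := by
  rw [hσ]
  exact Submodule.subset_span hs

/-- A functional that is nonnegative on a face becomes nonnegative on the whole cone after adding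
a large multiple of a functional defining that face. -/
lemma exists_add_mul_nonneg (hσ : σ = (PointedCone.hull ℝ (T : Set (Fin n → ℝ)) : Set _))
    {g w : (Fin n → ℝ) →ₗ[ℝ] ℝ} (hg : ∀ x ∈ σ, 0 ≤ g x)
    (hw : ∀ s ∈ T, g s = 0 → 0 ≤ w s) : ∃ N : ℝ, ∀ x ∈ σ, 0 ≤ w x + N * g x := by
  refine ⟨∑ s ∈ T, |w s| / g s, ?_⟩
  refine nonneg_of_nonneg_generators (w := w + (∑ s ∈ T, |w s| / g s) • g) hσ fun s hs => ?_
  have hgs := hg s (generator_mem hσ hs)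
  simp only [LinearMap.add_apply, LinearMap.smul_apply, smul_eq_mul]
  rcases hgs.eq_or_lt with h0 | hpos
  · rw [← h0, mul_zero, add_zero]
    exact hw s hs h0.symm
  · have h1 : |w s| / g s ≤ ∑ s ∈ T, |w s| / g s :=
      Finset.single_le_sum (f := fun s => |w s| / g s)
        (fun r hr => div_nonneg (abs_nonneg _) (hg r (generator_mem hσ hr))) hs
    rw [div_le_iff₀ hpos] at h1
    linarith [neg_abs_le (w s)]

lemma IsFaceOf.nonneg (hσ : σ = (PointedCone.hull ℝ (T : Set (Fin n → ℝ)) : Set _))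
    (hG : IsFaceOf σ G) {w : (Fin n → ℝ) →ₗ[ℝ] ℝ} (hw : ∀ s ∈ T, s ∈ G → 0 ≤ w s) :
    ∀ x ∈ G, 0 ≤ w x := by
  obtain ⟨g, hg, rfl⟩ := hG
  obtain ⟨N, hN⟩ := exists_add_mul_nonneg hσ hg
    fun s hs h => hw s hs ⟨generator_mem hσ hs, h⟩
  rintro x ⟨hx, h0⟩
  simpa [h0] using hN x hx

lemma IsFaceOf.trans (hσ : σ = (PointedCone.hull ℝ (T : Set (Fin n → ℝ)) : Set _))
    (hG : IsFaceOf σ G) (hH : IsFaceOf G H) : IsFaceOf σ H := by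
  obtain ⟨g, hg, rfl⟩ := hG
  obtain ⟨w, hw, rfl⟩ := hH
  obtain ⟨N, hN⟩ := exists_add_mul_nonneg hσ hg
    fun s hs h => hw s ⟨generator_mem hσ hs, h⟩
  refine ⟨w + (N + 1) • g, fun x hx => ?_, ?_⟩
  · have h1 := hN x hx
    have h2 := hg x hx
    simp only [LinearMap.add_apply, LinearMap.smul_apply, smul_eq_mul]
    linarith
  · ext x
    simp only [Set.mem_ofPred_eq, LinearMap.add_apply, LinearMap.smul_apply, smul_eq_mul]
    constructor
    · rintro ⟨⟨hx, hgx⟩, hwx⟩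
      exact ⟨hx, by simp [hgx, hwx]⟩
    · rintro ⟨hx, h⟩
      have h1 := hN x hx
      have h2 := hg x hx
      have h3 : g x = 0 := by linarith
      exact ⟨⟨hx, h3⟩, by simpa [h3] using h⟩

lemma isFaceOf_singleton_zero (hσ : σ = (PointedCone.hull ℝ (T : Set (Fin n → ℝ)) : Set _))
    (hsc : IsStronglyConvex σ) : IsFaceOf σ {0} := by
  classical
  have hconv : Convex ℝ (σ \ {0}) := by
    have hadd : ∀ x ∈ σ, ∀ y ∈ σ, x + y ∈ σ := by
      subst hσ
      exact fun x hx y hy => Submodule.add_mem _ hx hy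
    have hsmul : ∀ a : ℝ, 0 ≤ a → ∀ x ∈ σ, a • x ∈ σ := by
      subst hσ
      exact fun a ha x hx => Submodule.smul_mem _ (⟨a, ha⟩ : NNReal) hx
    rintro x ⟨hx, hx0⟩ y ⟨hy, hy0⟩ a b ha hb hab
    refine ⟨hadd _ (hsmul a ha x hx) _ (hsmul b hb y hy), fun h => ?_⟩
    have h : a • x + b • y = 0 := h
    have hax : a • x = 0 := hsc _ (hsmul a ha x hx) (by
      rw [neg_eq_of_add_eq_zero_right h]
      exact hsmul b hb y hy)
    rw [hax, zero_add] at h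
    rcases smul_eq_zero.1 hax with ha0 | h0
    · rcases smul_eq_zero.1 h with hb0 | h0
      · linarith
      · exact hy0 h0
    · exact hx0 h0
  have hsub : convexHull ℝ ((T.erase 0 : Finset (Fin n → ℝ)) : Set (Fin n → ℝ)) ⊆ σ \ {0} :=
    convexHull_min (fun s hs => by
      have hs : s ≠ 0 ∧ s ∈ T := by simpa [and_comm] using hs
      exact ⟨generator_mem hσ hs.2, hs.1⟩) hconv
  obtain ⟨f, c, hf0, hf⟩ := geometric_hahn_banach_point_closed (x := (0 : Fin n → ℝ))
    (convex_convexHull ℝ _)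
    ((T.erase 0).finite_toSet.isCompact_convexHull ℝ).isClosed (fun h => (hsub h).2 rfl)
  rw [map_zero] at hf0
  have hT : ∀ s ∈ T, s ≠ 0 → 0 < f s := fun s hs h0 =>
    hf0.trans (hf s (subset_convexHull ℝ _ (by simp [h0, hs])))
  have key : ∀ x ∈ σ, x = 0 ∨ 0 < f x := by
    intro x hx
    subst hσ
    refine Submodule.span_induction (p := fun x _ => x = 0 ∨ 0 < f x) ?_ (Or.inl rfl) ?_ ?_ hx
    · intro s hs
      exact or_iff_not_imp_left.2 (hT s hs)
    · rintro x y _ _ (rfl | hx) (rfl | hy)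
      · simp
      · simp [hy]
      · simp [hx]
      · exact Or.inr (by rw [map_add]; exact add_pos hx hy)
    · rintro a x _ (rfl | hx)
      · simp
      · rcases a.2.eq_or_lt with ha | ha
        · left
          rw [show a = 0 from Subtype.ext ha.symm, zero_smul]
        · right
          have : f (a • x) = a.1 * f x := by
            rw [← smul_eq_mul, ← map_smul]
            rfl
          rw [this]
          exact mul_pos ha hx
  refine ⟨f.toLinearMap, fun x hx => ?_, ?_⟩
  · rcases key x hx with rfl | h
    · simp
    · exact h.le
  · ext x
    constructor
    · rintro rfl
      refine ⟨?_, by simp⟩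
      rw [hσ]
      exact Submodule.zero_mem _
    · rintro ⟨hx, h0⟩
      rcases key x hx with rfl | h
      · rfl
      · exact absurd h0 h.ne'

lemma IsFaceOf.zero_mem (hσ : σ = (PointedCone.hull ℝ (T : Set (Fin n → ℝ)) : Set _))
    (hF : IsFaceOf σ F) : (0 : Fin n → ℝ) ∈ F := by
  refine hF.mem_of_mem_span ?_ (Submodule.zero_mem _)
  rw [hσ]
  exact Submodule.zero_mem _

lemma faceDim_singleton_zero : faceDim ({0} : Set (Fin n → ℝ)) = 0 := by
  rw [faceDim, Submodule.span_zero_singleton, finrank_bot]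

/-- Tilting a supporting functional `u` of `F` towards `t` until it meets another generator of
`G` yields a face strictly between. -/
lemma exists_tilted_face (hσ : σ = (PointedCone.hull ℝ (T : Set (Fin n → ℝ)) : Set _))
    (hG : IsFaceOf σ G) {u t : (Fin n → ℝ) →ₗ[ℝ] ℝ} (hu : ∀ x ∈ σ, 0 ≤ u x)
    (hne : ∃ x ∈ G, 0 < u x) (ht : ∀ x ∈ σ, u x = 0 → t x = 0) :
    ∃ m : ℝ, (∃ s ∈ T, s ∈ G ∧ 0 < u s ∧ t s = m * u s) ∧ (∀ x ∈ G, m * u x ≤ t x) ∧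
      IsFaceOf σ {x | x ∈ G ∧ t x = m * u x} := by
  classical
  have hne' : (T.filter fun s => s ∈ G ∧ 0 < u s).Nonempty := by
    by_contra h
    rw [Finset.not_nonempty_iff_eq_empty, Finset.filter_eq_empty_iff] at h
    obtain ⟨x, hx, hux⟩ := hne
    have := hG.nonneg hσ (w := -u) (fun s hs hsG => by
      have := h hs
      simp only [not_and, not_lt] at this
      simpa using this hsG) x hx
    simp only [LinearMap.neg_apply] at this
    linarith
  obtain ⟨s, hs, hmin⟩ := Finset.exists_min_image _ (fun s => t s / u s) hne'
  simp only [Finset.mem_filter] at hs hmin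
  obtain ⟨hsT, hsG, hus⟩ := hs
  have hle : ∀ x ∈ G, 0 ≤ (t - (t s / u s) • u) x := by
    refine hG.nonneg hσ fun r hr hrG => ?_
    simp only [LinearMap.sub_apply, LinearMap.smul_apply, smul_eq_mul, sub_nonneg]
    rcases (hu r (generator_mem hσ hr)).eq_or_lt with h0 | hpos
    · rw [← h0, ht r (generator_mem hσ hr) h0.symm, mul_zero]
    · exact (le_div_iff₀ hpos).1 (hmin r ⟨hr, hrG, hpos⟩)
  refine ⟨t s / u s, ⟨s, hsT, hsG, hus, by field_simp⟩, fun x hx => ?_, ?_⟩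
  · simpa using hle x hx
  · refine hG.trans hσ ⟨t - (t s / u s) • u, hle, ?_⟩
    ext x
    simp [sub_eq_zero]

lemma exists_transverse_functional (hG : IsFaceOf σ G) {u : (Fin n → ℝ) →ₗ[ℝ] ℝ}
    (hu : ∀ x ∈ σ, 0 ≤ u x) (hd : faceDim {x | x ∈ σ ∧ u x = 0} + 2 ≤ faceDim G) :
    ∃ (t : (Fin n → ℝ) →ₗ[ℝ] ℝ) (x₀ x₁ : Fin n → ℝ), x₀ ∈ G ∧ x₁ ∈ G ∧ 0 < u x₀ ∧ t x₀ = 0 ∧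
      t x₁ ≠ 0 ∧ (∀ x ∈ σ, u x = 0 → t x = 0) ∧ ∀ c : ℝ, ∃ x ∈ G, t x ≠ c * u x := by
  set F : Set (Fin n → ℝ) := {x | x ∈ σ ∧ u x = 0} with hFdef
  obtain ⟨x₀, hx₀G, hx₀F⟩ : ∃ x ∈ G, x ∉ F := by
    by_contra! h
    have := faceDim_mono (n := n) h
    omega
  have hux₀ : 0 < u x₀ := (hu x₀ (hG.subset hx₀G)).lt_of_ne
    fun h => hx₀F ⟨hG.subset hx₀G, h.symm⟩
  set P := Submodule.span ℝ F ⊔ Submodule.span ℝ {x₀} with hP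
  have hPd : finrank ℝ P ≤ faceDim F + 1 :=
    (Submodule.finrank_add_le_finrank_add_finrank _ _).trans
      (Nat.add_le_add_left ((finrank_span_le_card {x₀}).trans (by simp)) _)
  obtain ⟨x₁, hx₁G, hx₁P⟩ : ∃ x ∈ G, x ∉ P := by
    by_contra! h
    have : faceDim G ≤ finrank ℝ P := Submodule.finrank_mono (Submodule.span_le.2 h)
    omega
  obtain ⟨t, htx₁, htP⟩ := P.exists_le_ker_of_notMem hx₁P
  have htx₀ : t x₀ = 0 :=
    htP (le_sup_right (a := Submodule.span ℝ F) (Submodule.mem_span_singleton_self x₀))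
  refine ⟨t, x₀, x₁, hx₀G, hx₁G, hux₀, htx₀, htx₁, fun x hx h =>
    htP (le_sup_left (a := Submodule.span ℝ F) (Submodule.subset_span ⟨hx, h⟩)), fun c => ?_⟩
  by_contra! h
  have hc : c = 0 := by
    have := h x₀ hx₀G
    rw [htx₀] at this
    exact (mul_eq_zero.1 this.symm).resolve_right hux₀.ne'
  exact htx₁ (by rw [h x₁ hx₁G, hc, zero_mul])

lemma IsFaceOf.exists_between (hσ : σ = (PointedCone.hull ℝ (T : Set (Fin n → ℝ)) : Set _))
    (hF : IsFaceOf σ F) (hG : IsFaceOf σ G) (hFG : F ⊆ G) (hd : faceDim F + 2 ≤ faceDim G) :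
    ∃ H, IsFaceOf σ H ∧ F ⊆ H ∧ faceDim F < faceDim H ∧ faceDim H < faceDim G := by
  have hF' := hF
  obtain ⟨u, hu, rfl⟩ := hF'
  obtain ⟨t, x₀, -, hx₀, -, hux₀, -, -, htF, hneq⟩ := exists_transverse_functional hG hu hd
  obtain ⟨m, ⟨s, -, hsG, hus, hts⟩, -, hH⟩ := exists_tilted_face hσ hG hu ⟨x₀, hx₀, hux₀⟩ htF
  have hFH : {x | x ∈ σ ∧ u x = 0} ⊆ {x | x ∈ G ∧ t x = m * u x} :=
    fun x hx => ⟨hFG hx, by rw [htF x hx.1 hx.2, hx.2, mul_zero]⟩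
  refine ⟨_, hH, hFH, hF.faceDim_lt hH hFH fun h => ?_, hH.faceDim_lt hG (fun x hx => hx.1)
    fun h => ?_⟩
  · have : s ∈ {x | x ∈ σ ∧ u x = 0} := h ▸ ⟨hsG, hts⟩
    exact hus.ne' this.2
  · obtain ⟨x, hx, hne⟩ := hneq m
    rw [← h] at hx
    exact hne hx.2

/-- The diamond property of the face lattice of a polyhedral cone. -/
lemma IsFaceOf.exists_diamond (hσ : σ = (PointedCone.hull ℝ (T : Set (Fin n → ℝ)) : Set _))
    (hF : IsFaceOf σ F) (hG : IsFaceOf σ G) (hFG : F ⊆ G) (hd : faceDim G = faceDim F + 2) :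
    ∃ H₁ H₂ : Set (Fin n → ℝ), H₁ ≠ H₂ ∧
      (IsFaceOf σ H₁ ∧ faceDim H₁ = faceDim F + 1 ∧ F ⊆ H₁ ∧ H₁ ⊆ G) ∧
      (IsFaceOf σ H₂ ∧ faceDim H₂ = faceDim F + 1 ∧ F ⊆ H₂ ∧ H₂ ⊆ G) ∧
      ∀ H, IsFaceOf σ H → faceDim H = faceDim F + 1 → F ⊆ H → H ⊆ G → H = H₁ ∨ H = H₂ := by
  have hF' := hF
  obtain ⟨u, hu, rfl⟩ := hF'
  set F : Set (Fin n → ℝ) := {x | x ∈ σ ∧ u x = 0} with hFdef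
  obtain ⟨t, x₀, x₁, hx₀G, hx₁G, hux₀, htx₀, htx₁, htF, hneq⟩ :=
    exists_transverse_functional hG hu hd.ge
  set P := Submodule.span ℝ F ⊔ Submodule.span ℝ {x₀} with hP
  have hx₀F : x₀ ∉ F := fun h => hux₀.ne' h.2
  have hx₁P : x₁ ∉ P := by
    have : P ≤ LinearMap.ker t := by
      refine sup_le (Submodule.span_le.2 fun x hx => htF x hx.1 hx.2) ?_
      rw [Submodule.span_singleton_le_iff_mem]
      exact htx₀
    exact fun h => htx₁ (this h)
  have hspan : Submodule.span ℝ G ≤ P ⊔ Submodule.span ℝ {x₁} := by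
    have hlt : finrank ℝ P < finrank ℝ ↥(P ⊔ Submodule.span ℝ {x₁}) := by
      refine Submodule.finrank_lt_finrank_of_lt (lt_of_le_of_ne le_sup_left fun h => hx₁P ?_)
      rw [h]
      exact le_sup_right (a := P) (Submodule.mem_span_singleton_self x₁)
    have hFP : finrank ℝ ↥(Submodule.span ℝ F) < finrank ℝ P := by
      refine Submodule.finrank_lt_finrank_of_lt (lt_of_le_of_ne le_sup_left fun h => hx₀F ?_)
      refine hF.mem_of_mem_span (hG.subset hx₀G) ?_
      rw [h]
      exact le_sup_right (a := Submodule.span ℝ F) (Submodule.mem_span_singleton_self x₀)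
    have hle : P ⊔ Submodule.span ℝ {x₁} ≤ Submodule.span ℝ G := by
      refine sup_le (sup_le (Submodule.span_mono hFG) ?_) ?_ <;>
      · rw [Submodule.span_singleton_le_iff_mem]
        exact Submodule.subset_span (by assumption)
    refine (Submodule.eq_of_le_of_finrank_le hle ?_).ge
    change faceDim G ≤ _
    have : faceDim F = finrank ℝ ↥(Submodule.span ℝ F) := rfl
    omega
  have hzero : ∀ w : (Fin n → ℝ) →ₗ[ℝ] ℝ, (∀ x ∈ F, w x = 0) → w x₀ = 0 → w x₁ = 0 →
      ∀ x ∈ G, w x = 0 := by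
    intro w h h0 h1 x hx
    have : P ⊔ Submodule.span ℝ {x₁} ≤ LinearMap.ker w := by
      refine sup_le (sup_le (Submodule.span_le.2 h) ?_) ?_ <;>
      · rw [Submodule.span_singleton_le_iff_mem]
        assumption
    exact this (hspan (Submodule.subset_span hx))
  obtain ⟨m, ⟨s, hsT, hsG, hus, hts⟩, hm, hmF⟩ :=
    exists_tilted_face hσ hG hu ⟨x₀, hx₀G, hux₀⟩ htF
  obtain ⟨M, ⟨r, hrT, hrG, hur, htr⟩, hM, hMF⟩ :=
    exists_tilted_face hσ hG (t := -t) hu ⟨x₀, hx₀G, hux₀⟩ (fun x hx h => by simp [htF x hx h])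
  simp only [LinearMap.neg_apply] at htr hM hMF
  have hdim : ∀ H, IsFaceOf σ H → F ⊆ H → H ⊆ G → H ≠ G → (∃ y ∈ H, 0 < u y) →
      faceDim H = faceDim F + 1 := by
    rintro H hH hFH hHG hne ⟨y, hy, huy⟩
    have h1 := hH.faceDim_lt hG hHG hne
    have h2 := hF.faceDim_lt hH hFH (by
      rintro h
      rw [← h] at hy
      exact huy.ne' hy.2)
    omega
  have hFm : F ⊆ {x | x ∈ G ∧ t x = m * u x} :=
    fun x hx => ⟨hFG hx, by rw [htF x hx.1 hx.2, hx.2, mul_zero]⟩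
  have hFM : F ⊆ {x | x ∈ G ∧ -t x = M * u x} :=
    fun x hx => ⟨hFG hx, by rw [htF x hx.1 hx.2, hx.2, mul_zero, neg_zero]⟩
  have hmd : faceDim {x | x ∈ G ∧ t x = m * u x} = faceDim F + 1 := by
    refine hdim _ hmF hFm (fun x hx => hx.1) (fun h => ?_) ⟨s, ⟨hsG, hts⟩, hus⟩
    obtain ⟨x, hx, hne⟩ := hneq m
    rw [← h] at hx
    exact hne hx.2
  have hMd : faceDim {x | x ∈ G ∧ -t x = M * u x} = faceDim F + 1 := by
    refine hdim _ hMF hFM (fun x hx => hx.1) (fun h => ?_) ⟨r, ⟨hrG, htr⟩, hur⟩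
    obtain ⟨x, hx, hne⟩ := hneq (-M)
    rw [← h] at hx
    exact hne (by linarith [hx.2])
  refine ⟨_, _, ?_, ⟨hmF, hmd, hFm, fun x hx => hx.1⟩, ⟨hMF, hMd, hFM, fun x hx => hx.1⟩, ?_⟩
  · intro h
    have h1 : s ∈ {x | x ∈ G ∧ -t x = M * u x} := h ▸ ⟨hsG, hts⟩
    have h2 : m = -M := mul_right_cancel₀ hus.ne' (by rw [← hts]; linarith [h1.2])
    obtain ⟨x, hx, hne⟩ := hneq m
    have h3 := hm x hx
    have h4 := hM x hx
    rw [h2] at h3 hne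
    exact hne (by linarith)
  · intro H hH hHd hFH hHG
    obtain ⟨y, hy, huy⟩ : ∃ y ∈ H, 0 < u y := by
      by_contra! h
      have : faceDim H ≤ faceDim F := faceDim_mono fun x hx =>
        ⟨hH.subset hx, (h x hx).antisymm (hu x (hH.subset hx))⟩
      omega
    have hHm : ∀ H', IsFaceOf σ H' → faceDim H' = faceDim F + 1 → (∀ x ∈ H, x ∈ H') → H = H' :=
      fun H' hH' hd' h => hH.eq_of_subset hH' h (by omega)
    have hH' := hH
    obtain ⟨w, hw, hHw⟩ := hH'
    have hw0 : ∀ x ∈ H, w x = 0 := fun x hx => by rw [hHw] at hx; exact hx.2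
    have hwu : ∀ x ∈ G, w x = (w x₁ - w x₀ / u x₀ * u x₁) / t x₁ * t x + w x₀ / u x₀ * u x := by
      intro x hx
      have := hzero (w - ((w x₁ - w x₀ / u x₀ * u x₁) / t x₁) • t - (w x₀ / u x₀) • u)
        (fun z hz => by simp [hw0 z (hFH hz), htF z hz.1 hz.2, hz.2])
        (by simp [htx₀]; field_simp; simp) (by simp; field_simp; ring) x hx
      simp only [LinearMap.sub_apply, LinearMap.smul_apply, smul_eq_mul] at this
      linarith
    set a := (w x₁ - w x₀ / u x₀ * u x₁) / t x₁
    set b := w x₀ / u x₀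
    have hy0 : a * t y + b * u y = 0 := by rw [← hwu y (hHG hy), hw0 y hy]
    have ha : a ≠ 0 := by
      intro ha
      rw [ha, zero_mul, zero_add] at hy0
      have hb := (mul_eq_zero.1 hy0).resolve_right huy.ne'
      have : faceDim G ≤ faceDim H := faceDim_mono fun x hx => by
        rw [hHw]
        exact ⟨hG.subset hx, by rw [hwu x hx, ha, hb]; ring⟩
      omega
    have hwG : ∀ x ∈ G, 0 ≤ a * t x + b * u x := fun x hx => by
      rw [← hwu x hx]
      exact hw x (hG.subset hx)
    rcases ha.lt_or_gt with ha | ha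
    · right
      have h1 : 0 ≤ b - a * M := nonneg_of_mul_nonneg_left
        (by linear_combination hwG r hrG - a * htr) hur
      have h2 : (b - a * M) * u y ≤ 0 := by nlinarith [hM y (hHG hy)]
      have h3 : b - a * M = 0 := (nonpos_of_mul_nonpos_left h2 huy).antisymm h1
      refine hHm _ hMF hMd fun x hx => ⟨hHG hx, mul_left_cancel₀ ha.ne ?_⟩
      have h4 := hwu x (hHG hx)
      rw [hw0 x hx] at h4
      linear_combination h4 + u x * h3
    · left
      have h1 : 0 ≤ b + a * m := nonneg_of_mul_nonneg_left
        (by linear_combination hwG s hsG + a * hts) hus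
      have h2 : (b + a * m) * u y ≤ 0 := by nlinarith [hm y (hHG hy)]
      have h3 : b + a * m = 0 := (nonpos_of_mul_nonpos_left h2 huy).antisymm h1
      refine hHm _ hmF hmd fun x hx => ⟨hHG hx, mul_left_cancel₀ ha.ne' ?_⟩
      have h4 := hwu x (hHG hx)
      rw [hw0 x hx] at h4
      linear_combination -h4 - u x * h3

end ConeFaces

section FaceCounting

variable {n : ℕ} {σ : Set (Fin n → ℝ)} {T : Finset (Fin n → ℝ)}

/-- Two distinct `d`-dimensional faces lie in at most one common `d + 1`-dimensional face. -/
lemma IsFaceOf.join_unique {A A' B B' : Set (Fin n → ℝ)} (hA : IsFaceOf σ A)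
    (hA' : IsFaceOf σ A') (hB : IsFaceOf σ B) (hB' : IsFaceOf σ B') (hne : A ≠ A')
    (hd : faceDim A = faceDim A') (hBd : faceDim B = faceDim A + 1)
    (hBd' : faceDim B' = faceDim A + 1) (h1 : A ⊆ B) (h2 : A' ⊆ B) (h3 : A ⊆ B')
    (h4 : A' ⊆ B') : B = B' := by
  have hI := hB.inter hB'
  have hlt : faceDim A < faceDim (B ∩ B') := by
    refine hA.faceDim_lt hI (Set.subset_inter h1 h3) fun h => hne ?_
    refine (hA'.eq_of_subset hA ?_ hd.le).symm
    rw [h]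
    exact Set.subset_inter h2 h4
  exact (hI.eq_of_subset hB Set.inter_subset_left (by omega)).symm.trans
    (hI.eq_of_subset hB' Set.inter_subset_right (by omega))

lemma IsFaceOf.span_le_sup {A A' B : Set (Fin n → ℝ)} (hA : IsFaceOf σ A)
    (hA' : IsFaceOf σ A') (hne : A ≠ A') (hd : faceDim A = faceDim A')
    (hBd : faceDim B = faceDim A + 1) (h1 : A ⊆ B) (h2 : A' ⊆ B) :
    Submodule.span ℝ B ≤ Submodule.span ℝ A ⊔ Submodule.span ℝ A' := by
  have hlt : faceDim A < finrank ℝ ↥(Submodule.span ℝ A ⊔ Submodule.span ℝ A') := by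
    refine Submodule.finrank_lt_finrank_of_lt (lt_of_le_of_ne le_sup_left fun h => hne ?_)
    refine (hA'.eq_of_subset hA (fun x hx => hA.mem_of_mem_span (hA'.subset hx) ?_) hd.le).symm
    rw [h]
    exact le_sup_right (a := Submodule.span ℝ A) (Submodule.subset_span hx)
  refine (Submodule.eq_of_le_of_finrank_le
    (sup_le (Submodule.span_mono h1) (Submodule.span_mono h2)) ?_).ge
  change faceDim B ≤ _
  omega

/-- A face contained in a finite union of faces is contained in one of them. -/
lemma IsFaceOf.subset_of_subset_iUnion
    (hσ : σ = (PointedCone.hull ℝ (T : Set (Fin n → ℝ)) : Set _))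
    {F : Set (Fin n → ℝ)} (hF : IsFaceOf σ F) {ι : Type*} [Fintype ι] {G : ι → Set (Fin n → ℝ)}
    (hG : ∀ i, IsFaceOf σ (G i)) (h : F ⊆ ⋃ i, G i) : ∃ i, F ⊆ G i := by
  by_contra! hcon
  choose x hxF hxG using fun i => Set.not_subset.1 (hcon i)
  choose u hu hGu using hG
  have hsum : ∑ i, x i ∈ F := by
    refine hF.mem_of_mem_span ?_ (Submodule.sum_mem _ fun i _ => Submodule.subset_span (hxF i))
    have hxσ := fun i => hF.subset (hxF i)
    rw [hσ] at hxσ ⊢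
    exact Submodule.sum_mem _ fun i _ => hxσ i
  obtain ⟨i, hi⟩ := Set.mem_iUnion.1 (h hsum)
  rw [hGu i] at hi
  have h0 := hi.2
  rw [map_sum, Finset.sum_eq_zero_iff_of_nonneg fun j _ => hu i _ (hF.subset (hxF j))] at h0
  exact hxG i (by rw [hGu i]; exact ⟨hF.subset (hxF i), h0 i (Finset.mem_univ i)⟩)

/-- A two-dimensional face containing a ray has exactly one further ray. -/
lemma IsFaceOf.exists_other_ray (hσ : σ = (PointedCone.hull ℝ (T : Set (Fin n → ℝ)) : Set _))
    (hsc : IsStronglyConvex σ) {e r : Set (Fin n → ℝ)} (he : IsFaceOf σ e) (hed : faceDim e = 2)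
    (hr : IsFaceOf σ r) (hrd : faceDim r = 1) (hre : r ⊆ e) :
    ∃ r', IsFaceOf σ r' ∧ faceDim r' = 1 ∧ r' ⊆ e ∧ r' ≠ r ∧
      ∀ q, IsFaceOf σ q → faceDim q = 1 → q ⊆ e → q = r ∨ q = r' := by
  have h0 := isFaceOf_singleton_zero hσ hsc
  have hsub : ∀ F, IsFaceOf σ F → ({0} : Set (Fin n → ℝ)) ⊆ F := fun F hF =>
    Set.singleton_subset_iff.2 (hF.zero_mem hσ)
  obtain ⟨r₁, r₂, hne, ⟨h1, h1d, -, h1e⟩, ⟨h2, h2d, -, h2e⟩, hall⟩ :=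
    h0.exists_diamond hσ he (hsub e he) (by rw [hed, faceDim_singleton_zero])
  simp only [faceDim_singleton_zero, zero_add] at h1d h2d hall
  rcases hall r hr hrd (hsub r hr) hre with rfl | rfl
  · exact ⟨r₂, h2, h2d, h2e, hne.symm, fun q hq hqd hqe => hall q hq hqd (hsub q hq) hqe⟩
  · exact ⟨r₁, h1, h1d, h1e, hne, fun q hq hqd hqe => (hall q hq hqd (hsub q hq) hqe).symm⟩

/-- In a face, a subface of codimension two contained in an intermediate face is contained in
exactly one further intermediate face. -/
lemma IsFaceOf.exists_other_face (hσ : σ = (PointedCone.hull ℝ (T : Set (Fin n → ℝ)) : Set _))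
    {F G A : Set (Fin n → ℝ)} (hF : IsFaceOf σ F) (hG : IsFaceOf σ G) (hA : IsFaceOf σ A)
    (hd : faceDim G = faceDim F + 2) (hAd : faceDim A = faceDim F + 1) (hFA : F ⊆ A)
    (hAG : A ⊆ G) :
    ∃ A', IsFaceOf σ A' ∧ faceDim A' = faceDim F + 1 ∧ F ⊆ A' ∧ A' ⊆ G ∧ A' ≠ A := by
  obtain ⟨H₁, H₂, hne, ⟨h1, h1d, hF1, h1G⟩, ⟨h2, h2d, hF2, h2G⟩, hall⟩ :=
    hF.exists_diamond hσ hG (hFA.trans hAG) hd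
  rcases hall A hA hAd hFA hAG with rfl | rfl
  · exact ⟨H₂, h2, h2d, hF2, h2G, hne.symm⟩
  · exact ⟨H₁, h1, h1d, hF1, h1G, hne⟩

/-- The rays and two-dimensional faces of a simplicial three-dimensional face `f` containing the
ray `τ`. -/
lemma IsSimplicialFace.exists_rays
    (hσ : σ = (PointedCone.hull ℝ (T : Set (Fin n → ℝ)) : Set _)) (hsc : IsStronglyConvex σ)
    {f τ : Set (Fin n → ℝ)} (hs : IsSimplicialFace σ f) (hf : IsFaceOf σ f) (hfd : faceDim f = 3)
    (hτ : IsFaceOf σ τ) (hτd : faceDim τ = 1) (hτf : τ ⊆ f) :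
    ∃ e₁ e₂ r₁ r₂ : Set (Fin n → ℝ), e₁ ≠ e₂ ∧ r₁ ≠ r₂ ∧ r₁ ≠ τ ∧ r₂ ≠ τ ∧
      (IsFaceOf σ e₁ ∧ faceDim e₁ = 2 ∧ τ ⊆ e₁ ∧ e₁ ⊆ f) ∧
      (IsFaceOf σ e₂ ∧ faceDim e₂ = 2 ∧ τ ⊆ e₂ ∧ e₂ ⊆ f) ∧
      (IsFaceOf σ r₁ ∧ faceDim r₁ = 1 ∧ r₁ ⊆ e₁) ∧
      (IsFaceOf σ r₂ ∧ faceDim r₂ = 1 ∧ r₂ ⊆ e₂) ∧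
      (∀ e, IsFaceOf σ e → faceDim e = 2 → τ ⊆ e → e ⊆ f → e = e₁ ∨ e = e₂) ∧
      ∀ r, IsFaceOf σ r → faceDim r = 1 → r ⊆ f → r = τ ∨ r = r₁ ∨ r = r₂ := by
  obtain ⟨e₁, e₂, hne, ⟨h1, h1d, hτ1, h1f⟩, ⟨h2, h2d, hτ2, h2f⟩, hall⟩ :=
    hτ.exists_diamond hσ hf hτf (by rw [hfd, hτd])
  rw [hτd] at h1d h2d hall
  obtain ⟨r₁, hr1, hr1d, hr1e, hr1τ, -⟩ := h1.exists_other_ray hσ hsc h1d hτ hτd hτ1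
  obtain ⟨r₂, hr2, hr2d, hr2e, hr2τ, -⟩ := h2.exists_other_ray hσ hsc h2d hτ hτd hτ2
  have hr12 : r₁ ≠ r₂ := by
    rintro rfl
    exact hne (hτ.join_unique hr1 h1 h2 hr1τ.symm (by omega) (by omega) (by omega)
      hτ1 hr1e hτ2 hr2e)
  refine ⟨e₁, e₂, r₁, r₂, hne, hr12, hr1τ, hr2τ, ⟨h1, h1d, hτ1, h1f⟩, ⟨h2, h2d, hτ2, h2f⟩,
    ⟨hr1, hr1d, hr1e⟩, ⟨hr2, hr2d, hr2e⟩, hall, ?_⟩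
  have hcard : ({r | IsFaceOf σ r ∧ faceDim r = 1 ∧ r ⊆ f} : Set (Set (Fin n → ℝ))).ncard = 3 :=
    Eq.trans hs hfd
  have hsub : ({τ, r₁, r₂} : Set (Set (Fin n → ℝ))) ⊆
      {r | IsFaceOf σ r ∧ faceDim r = 1 ∧ r ⊆ f} := by
    rintro r (rfl | rfl | rfl)
    · exact ⟨hτ, hτd, hτf⟩
    · exact ⟨hr1, hr1d, hr1e.trans h1f⟩
    · exact ⟨hr2, hr2d, hr2e.trans h2f⟩
  have h3 : ({τ, r₁, r₂} : Set (Set (Fin n → ℝ))).ncard = 3 :=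
    Set.ncard_eq_three.2 ⟨τ, r₁, r₂, hr1τ.symm, hr2τ.symm, hr12, rfl⟩
  have heq := Set.eq_of_subset_of_ncard_le hsub (by rw [hcard, h3])
    (Set.finite_of_ncard_ne_zero (by rw [hcard]; norm_num))
  intro r hr hrd hrf
  have : r ∈ ({τ, r₁, r₂} : Set (Set (Fin n → ℝ))) := heq ▸ ⟨hr, hrd, hrf⟩
  simpa using this

/-- A simplicial three-dimensional face has exactly one edge opposite to a given ray. -/
lemma IsSimplicialFace.existsUnique_opposite
    (hσ : σ = (PointedCone.hull ℝ (T : Set (Fin n → ℝ)) : Set _)) (hsc : IsStronglyConvex σ)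
    {f τ : Set (Fin n → ℝ)} (hs : IsSimplicialFace σ f) (hf : IsFaceOf σ f) (hfd : faceDim f = 3)
    (hτ : IsFaceOf σ τ) (hτd : faceDim τ = 1) (hτf : τ ⊆ f) :
    ∃! g, (IsFaceOf σ g ∧ faceDim g = 2 ∧ ¬ τ ⊆ g) ∧ g ⊆ f := by
  obtain ⟨e₁, e₂, r₁, r₂, hne, hr12, hr1τ, hr2τ, ⟨h1, h1d, hτ1, h1f⟩, ⟨h2, h2d, hτ2, h2f⟩,
    ⟨hr1, hr1d, hr1e⟩, ⟨hr2, hr2d, hr2e⟩, -, hrays⟩ := hs.exists_rays hσ hsc hf hfd hτ hτd hτf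
  have hmem : ∀ g, IsFaceOf σ g → faceDim g = 2 → ¬ τ ⊆ g → g ⊆ f → r₁ ⊆ g ∧ r₂ ⊆ g := by
    intro g hg hgd hτg hgf
    have h0 := isFaceOf_singleton_zero hσ hsc
    obtain ⟨q, q', hqq, ⟨hq, hqd, -, hqg⟩, ⟨hq', hqd', -, hqg'⟩, -⟩ :=
      h0.exists_diamond hσ hg (Set.singleton_subset_iff.2 (hg.zero_mem hσ))
        (by rw [hgd, faceDim_singleton_zero])
    rw [faceDim_singleton_zero, zero_add] at hqd hqd'
    rcases hrays q hq hqd (hqg.trans hgf) with rfl | rfl | rfl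
    · exact absurd hqg hτg
    · rcases hrays q' hq' hqd' (hqg'.trans hgf) with rfl | rfl | rfl
      · exact absurd hqg' hτg
      · exact absurd rfl hqq
      · exact ⟨hqg, hqg'⟩
    · rcases hrays q' hq' hqd' (hqg'.trans hgf) with rfl | rfl | rfl
      · exact absurd hqg' hτg
      · exact ⟨hqg', hqg⟩
      · exact absurd rfl hqq
  obtain ⟨g, hg, hgd, hrg, hgf, hge⟩ :=
    hr1.exists_other_face hσ hf h1 (by omega) (by omega) hr1e h1f
  have hτg : ¬ τ ⊆ g := fun h => hge (hτ.join_unique hr1 hg h1 hr1τ.symm (by omega) (by omega)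
    (by omega) h hrg hτ1 hr1e)
  refine ⟨g, ⟨⟨hg, by omega, hτg⟩, hgf⟩, ?_⟩
  rintro g' ⟨⟨hg', hgd', hτg'⟩, hgf'⟩
  obtain ⟨ha, hb⟩ := hmem g' hg' hgd' hτg' hgf'
  obtain ⟨ha', hb'⟩ := hmem g hg (by omega) hτg hgf
  exact hr1.join_unique hr2 hg' hg hr12 (by omega) (by omega) (by omega) ha hb ha' hb'

lemma Finset.card_eq_of_existsUnique {α β : Type*} (s : Finset α) (t : Finset β)
    (r : α → β → Prop) (hs : ∀ a ∈ s, ∃! b, b ∈ t ∧ r a b) (ht : ∀ b ∈ t, ∃! a, a ∈ s ∧ r a b) :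
    s.card = t.card := by
  classical
  have := Finset.card_mul_eq_card_mul (s := s) (t := t) r (m := 1) (n := 1) (fun a ha => ?_)
    (fun b hb => ?_)
  · simpa using this
  · obtain ⟨b, hb, hu⟩ := hs a ha
    rw [Finset.card_eq_one]
    exact ⟨b, Finset.eq_singleton_iff_unique_mem.2
      ⟨by simpa [Finset.mem_bipartiteAbove] using hb,
        fun c hc => hu c (by simpa [Finset.mem_bipartiteAbove] using hc)⟩⟩
  · obtain ⟨a, ha, hu⟩ := ht b hb
    rw [Finset.card_eq_one]
    exact ⟨a, Finset.eq_singleton_iff_unique_mem.2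
      ⟨by simpa [Finset.mem_bipartiteBelow] using ha,
        fun c hc => hu c (by simpa [Finset.mem_bipartiteBelow] using hc)⟩⟩

end FaceCounting

section LinkCounting

variable {n : ℕ} {σ τ : Set (Fin n → ℝ)} {T : Finset (Fin n → ℝ)}

lemma exists_edge_of_ray (hσ : σ = (PointedCone.hull ℝ (T : Set (Fin n → ℝ)) : Set _))
    (hfull : faceDim σ = 4) (hτ : IsFaceOf σ τ) (hτd : faceDim τ = 1) :
    ∃ e, IsFaceOf σ e ∧ faceDim e = 2 ∧ τ ⊆ e := by
  obtain ⟨H, hH, hτH, h1, h2⟩ := hτ.exists_between hσ (IsFaceOf.refl σ) hτ.subset (by omega)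
  obtain hd | hd : faceDim H = 2 ∨ faceDim H = 3 := by omega
  · exact ⟨H, hH, hd, hτH⟩
  · obtain ⟨e, -, -, ⟨he, hed, hτe, -⟩, -⟩ := hτ.exists_diamond hσ hH hτH (by omega)
    exact ⟨e, he, by omega, hτe⟩

lemma subset_link {U : Set (Fin n → ℝ)}
    (hU : U = {x | ∃ F, (IsFaceOf σ F ∧ faceDim F = 3 ∧ τ ⊆ F) ∧ x ∈ F})
    {f : Set (Fin n → ℝ)} (hf : IsFaceOf σ f) (hfd : faceDim f = 3) (hτf : τ ⊆ f) : f ⊆ U := by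
  subst hU
  exact fun x hx => ⟨f, ⟨hf, hfd, hτf⟩, hx⟩

lemma edge_subset_link (hσ : σ = (PointedCone.hull ℝ (T : Set (Fin n → ℝ)) : Set _))
    (hfull : faceDim σ = 4) {U : Set (Fin n → ℝ)}
    (hU : U = {x | ∃ F, (IsFaceOf σ F ∧ faceDim F = 3 ∧ τ ⊆ F) ∧ x ∈ F})
    {e : Set (Fin n → ℝ)} (he : IsFaceOf σ e) (hed : faceDim e = 2) (hτe : τ ⊆ e) : e ⊆ U := by
  obtain ⟨f, -, -, ⟨hf, hfd, hef, -⟩, -⟩ :=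
    he.exists_diamond hσ (IsFaceOf.refl σ) he.subset (by omega)
  exact hef.trans (subset_link hU hf (by omega) (hτe.trans hef))

lemma exists_facet_of_subset_link
    (hσ : σ = (PointedCone.hull ℝ (T : Set (Fin n → ℝ)) : Set _)) {U : Set (Fin n → ℝ)}
    (hU : U = {x | ∃ F, (IsFaceOf σ F ∧ faceDim F = 3 ∧ τ ⊆ F) ∧ x ∈ F})
    (hK : {F | IsFaceOf σ F ∧ faceDim F = 3 ∧ τ ⊆ F}.Finite)
    {g : Set (Fin n → ℝ)} (hg : IsFaceOf σ g) (hgU : g ⊆ U) :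
    ∃ f, (IsFaceOf σ f ∧ faceDim f = 3 ∧ τ ⊆ f) ∧ g ⊆ f := by
  have := hK.fintype
  obtain ⟨f, hf⟩ := hg.subset_of_subset_iUnion hσ
    (G := fun f : {F | IsFaceOf σ F ∧ faceDim F = 3 ∧ τ ⊆ F} => f.1) (fun f => f.2.1) (by
      rw [hU] at hgU
      intro x hx
      obtain ⟨f, hf, hxf⟩ := hgU hx
      exact Set.mem_iUnion.2 ⟨⟨f, hf⟩, hxf⟩)
  exact ⟨f.1, f.2, hf⟩

/-- There are as many edges through `τ` as facets through `τ`. -/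
lemma card_edges_through_ray (hσ : σ = (PointedCone.hull ℝ (T : Set (Fin n → ℝ)) : Set _))
    (hfull : faceDim σ = 4) (hτ : IsFaceOf σ τ) (hτd : faceDim τ = 1)
    {E K : Finset (Set (Fin n → ℝ))}
    (hE : ∀ e, e ∈ E ↔ IsFaceOf σ e ∧ faceDim e = 2 ∧ τ ⊆ e)
    (hK : ∀ f, f ∈ K ↔ IsFaceOf σ f ∧ faceDim f = 3 ∧ τ ⊆ f) : E.card = K.card := by
  classical
  have := Finset.card_mul_eq_card_mul (s := E) (t := K) (· ⊆ ·) (m := 2) (n := 2)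
    (fun e he => ?_) (fun f hf => ?_)
  · omega
  · obtain ⟨he, hed, hτe⟩ := (hE e).1 he
    obtain ⟨f₁, f₂, hne, ⟨h1, h1d, hef1, -⟩, ⟨h2, h2d, hef2, -⟩, hall⟩ :=
      he.exists_diamond hσ (IsFaceOf.refl σ) he.subset (by omega)
    rw [Finset.card_eq_two]
    refine ⟨f₁, f₂, hne, ?_⟩
    ext f
    simp only [Finset.mem_bipartiteAbove, hK, Finset.mem_insert, Finset.mem_singleton]
    constructor
    · rintro ⟨⟨hf, hfd, -⟩, hef⟩
      exact hall f hf (by omega) hef hf.subset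
    · rintro (rfl | rfl)
      · exact ⟨⟨h1, by omega, hτe.trans hef1⟩, hef1⟩
      · exact ⟨⟨h2, by omega, hτe.trans hef2⟩, hef2⟩
  · obtain ⟨hf, hfd, hτf⟩ := (hK f).1 hf
    obtain ⟨e₁, e₂, hne, ⟨h1, h1d, hτ1, h1f⟩, ⟨h2, h2d, hτ2, h2f⟩, hall⟩ :=
      hτ.exists_diamond hσ hf hτf (by omega)
    rw [Finset.card_eq_two]
    refine ⟨e₁, e₂, hne, ?_⟩
    ext e
    simp only [Finset.mem_bipartiteBelow, hE, Finset.mem_insert, Finset.mem_singleton]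
    constructor
    · rintro ⟨⟨he, hed, hτe⟩, hef⟩
      exact hall e he (by omega) hτe hef
    · rintro (rfl | rfl)
      · exact ⟨⟨h1, by omega, hτ1⟩, h1f⟩
      · exact ⟨⟨h2, by omega, hτ2⟩, h2f⟩

/-- There are `k + 1` rays and `2k` edges in the union of the `k` facets through `τ`. -/
lemma card_link (hσ : σ = (PointedCone.hull ℝ (T : Set (Fin n → ℝ)) : Set _))
    (hsc : IsStronglyConvex σ) (hfull : faceDim σ = 4) (hτ : IsFaceOf σ τ) (hτd : faceDim τ = 1)
    (hsimp : ∀ F, IsFaceOf σ F → faceDim F = 3 → τ ⊆ F → IsSimplicialFace σ F)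
    {U : Set (Fin n → ℝ)}
    (hU : U = {x | ∃ F, (IsFaceOf σ F ∧ faceDim F = 3 ∧ τ ⊆ F) ∧ x ∈ F})
    {R D K : Finset (Set (Fin n → ℝ))}
    (hR : ∀ r, r ∈ R ↔ IsFaceOf σ r ∧ faceDim r = 1 ∧ r ⊆ U)
    (hD : ∀ e, e ∈ D ↔ IsFaceOf σ e ∧ faceDim e = 2 ∧ e ⊆ U)
    (hK : ∀ f, f ∈ K ↔ IsFaceOf σ f ∧ faceDim f = 3 ∧ τ ⊆ f) :
    R.card = K.card + 1 ∧ D.card = 2 * K.card := by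
  classical
  have hKfin : {F | IsFaceOf σ F ∧ faceDim F = 3 ∧ τ ⊆ F}.Finite :=
    K.finite_toSet.subset fun f hf => (hK f).2 hf
  have hE : ∀ e, e ∈ D.filter (τ ⊆ ·) ↔ IsFaceOf σ e ∧ faceDim e = 2 ∧ τ ⊆ e := by
    intro e
    rw [Finset.mem_filter, hD]
    exact ⟨fun h => ⟨h.1.1, h.1.2.1, h.2⟩,
      fun h => ⟨⟨h.1, h.2.1, edge_subset_link hσ hfull hU h.1 h.2.1 h.2.2⟩, h.2.2⟩⟩
  have hEK := card_edges_through_ray hσ hfull hτ hτd hE hK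
  have hτU : τ ⊆ U := by
    obtain ⟨e, he, hed, hτe⟩ := exists_edge_of_ray hσ hfull hτ hτd
    exact hτe.trans (edge_subset_link hσ hfull hU he hed hτe)
  have hτR : τ ∈ R := (hR τ).2 ⟨hτ, hτd, hτU⟩
  have hRE : (R.erase τ).card = (D.filter (τ ⊆ ·)).card := by
    refine Finset.card_eq_of_existsUnique _ _ (· ⊆ ·) (fun r hr => ?_) (fun e he => ?_)
    · obtain ⟨hne, hr⟩ := Finset.mem_erase.1 hr
      obtain ⟨hr, hrd, hrU⟩ := (hR r).1 hr
      obtain ⟨f, ⟨hf, hfd, hτf⟩, hrf⟩ := exists_facet_of_subset_link hσ hU hKfin hr hrU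
      obtain ⟨e₁, e₂, r₁, r₂, -, -, -, -, ⟨h1, h1d, hτ1, -⟩, ⟨h2, h2d, hτ2, -⟩,
        ⟨-, -, hr1e⟩, ⟨-, -, hr2e⟩, -, hrays⟩ :=
        (hsimp f hf hfd hτf).exists_rays hσ hsc hf hfd hτ hτd hτf
      obtain ⟨e, he, hed, hτe, hre⟩ : ∃ e, IsFaceOf σ e ∧ faceDim e = 2 ∧ τ ⊆ e ∧ r ⊆ e := by
        rcases hrays r hr hrd hrf with rfl | rfl | rfl
        · exact absurd rfl hne
        · exact ⟨e₁, h1, h1d, hτ1, hr1e⟩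
        · exact ⟨e₂, h2, h2d, hτ2, hr2e⟩
      refine ⟨e, ⟨(hE e).2 ⟨he, hed, hτe⟩, hre⟩, ?_⟩
      rintro e' ⟨he', hre'⟩
      obtain ⟨he', hed', hτe'⟩ := (hE e').1 he'
      exact hτ.join_unique hr he' he hne.symm (by omega) (by omega) (by omega) hτe' hre' hτe hre
    · obtain ⟨he, hed, hτe⟩ := (hE e).1 he
      obtain ⟨r, hr, hrd, hre, hne, hall⟩ := he.exists_other_ray hσ hsc hed hτ hτd hτe
      refine ⟨r, ⟨Finset.mem_erase.2 ⟨hne, (hR r).2 ⟨hr, hrd,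
        hre.trans (edge_subset_link hσ hfull hU he hed hτe)⟩⟩, hre⟩, ?_⟩
      rintro q ⟨hq, hqe⟩
      obtain ⟨hqne, hq⟩ := Finset.mem_erase.1 hq
      obtain ⟨hq, hqd, -⟩ := (hR q).1 hq
      exact (hall q hq hqd hqe).resolve_left hqne
  have hOK : (D.filter (¬ τ ⊆ ·)).card = K.card := by
    refine Finset.card_eq_of_existsUnique _ _ (· ⊆ ·) (fun g hg => ?_) (fun f hf => ?_)
    · obtain ⟨hg, hτg⟩ := Finset.mem_filter.1 hg
      obtain ⟨hg, hgd, hgU⟩ := (hD g).1 hg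
      obtain ⟨f, ⟨hf, hfd, hτf⟩, hgf⟩ := exists_facet_of_subset_link hσ hU hKfin hg hgU
      refine ⟨f, ⟨(hK f).2 ⟨hf, hfd, hτf⟩, hgf⟩, ?_⟩
      rintro f' ⟨hf', hgf'⟩
      obtain ⟨hf', hfd', hτf'⟩ := (hK f').1 hf'
      have hI := hf'.inter hf
      have hlt : faceDim g < faceDim (f' ∩ f) := by
        refine hg.faceDim_lt hI (Set.subset_inter hgf' hgf) fun h => hτg ?_
        rw [h]
        exact Set.subset_inter hτf' hτf
      exact (hI.eq_of_subset hf' Set.inter_subset_left (by omega)).symm.trans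
        (hI.eq_of_subset hf Set.inter_subset_right (by omega))
    · obtain ⟨hf, hfd, hτf⟩ := (hK f).1 hf
      obtain ⟨g, ⟨⟨hg, hgd, hτg⟩, hgf⟩, hu⟩ :=
        (hsimp f hf hfd hτf).existsUnique_opposite hσ hsc hf hfd hτ hτd hτf
      refine ⟨g, ⟨Finset.mem_filter.2 ⟨(hD g).2 ⟨hg, hgd,
        hgf.trans (subset_link hU hf hfd hτf)⟩, hτg⟩, hgf⟩, ?_⟩
      rintro g' ⟨hg', hgf'⟩
      obtain ⟨hg', hτg'⟩ := Finset.mem_filter.1 hg'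
      obtain ⟨hg', hgd', -⟩ := (hD g').1 hg'
      exact hu g' ⟨⟨hg', hgd', hτg'⟩, hgf'⟩
  have hsplit := Finset.card_filter_add_card_filter_not (s := D) (τ ⊆ ·)
  have hpos := Finset.card_erase_add_one hτR
  omega

lemma span_rays_of_link (hσ : σ = (PointedCone.hull ℝ (T : Set (Fin n → ℝ)) : Set _))
    (hsc : IsStronglyConvex σ) (hfull : faceDim σ = 4) (hτ : IsFaceOf σ τ) (hτd : faceDim τ = 1)
    {U : Set (Fin n → ℝ)}
    (hU : U = {x | ∃ F, (IsFaceOf σ F ∧ faceDim F = 3 ∧ τ ⊆ F) ∧ x ∈ F})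
    {W : Submodule ℝ (Fin n → ℝ)}
    (hW : ∀ r, IsFaceOf σ r → faceDim r = 1 → r ⊆ U → Submodule.span ℝ r ≤ W) :
    Submodule.span ℝ σ ≤ W := by
  have hedge : ∀ e, IsFaceOf σ e → faceDim e = 2 → τ ⊆ e → Submodule.span ℝ e ≤ W := by
    intro e he hed hτe
    have heU := edge_subset_link hσ hfull hU he hed hτe
    obtain ⟨r, hr, hrd, hre, hne, -⟩ := he.exists_other_ray hσ hsc hed hτ hτd hτe
    exact (hr.span_le_sup hτ hne (by omega) (by omega) hre hτe).trans
      (sup_le (hW r hr hrd (hre.trans heU)) (hW τ hτ hτd (hτe.trans heU)))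
  have hfacet : ∀ f, IsFaceOf σ f → faceDim f = 3 → τ ⊆ f → Submodule.span ℝ f ≤ W := by
    intro f hf hfd hτf
    obtain ⟨e₁, e₂, hne, ⟨h1, h1d, hτ1, h1f⟩, ⟨h2, h2d, hτ2, h2f⟩, -⟩ :=
      hτ.exists_diamond hσ hf hτf (by omega)
    exact (h1.span_le_sup h2 hne (by omega) (by omega) h1f h2f).trans
      (sup_le (hedge e₁ h1 (by omega) hτ1) (hedge e₂ h2 (by omega) hτ2))
  obtain ⟨e, he, hed, hτe⟩ := exists_edge_of_ray hσ hfull hτ hτd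
  obtain ⟨f₁, f₂, hne, ⟨h1, h1d, he1, h1σ⟩, ⟨h2, h2d, he2, h2σ⟩, -⟩ :=
    he.exists_diamond hσ (IsFaceOf.refl σ) he.subset (by omega)
  exact (h1.span_le_sup h2 hne (by omega) (by omega) h1σ h2σ).trans
    (sup_le (hfacet f₁ h1 (by omega) (hτe.trans he1)) (hfacet f₂ h2 (by omega) (hτe.trans he2)))

end LinkCounting

section AlternatingForms

instance AlternatingMap.instModuleFiniteFin {K V : Type*} [Field K] [AddCommGroup V] [Module K V]
    [FiniteDimensional K V] (m : ℕ) : Module.Finite K (V [⋀^Fin m]→ₗ[K] K) :=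
  Module.Finite.equiv (exteriorPower.alternatingMapLinearEquiv (R := K) (M := V) (N := K)
    (n := m)).symm

lemma AlternatingMap.finrank_fin {K V : Type*} [Field K] [AddCommGroup V] [Module K V]
    [FiniteDimensional K V] (m : ℕ) :
    finrank K (V [⋀^Fin m]→ₗ[K] K) = (finrank K V).choose m := by
  rw [(exteriorPower.alternatingMapLinearEquiv (R := K) (M := V) (N := K) (n := m)).finrank_eq,
    Module.finrank_linearMap, exteriorPower.finrank_eq, finrank_self, mul_one]

lemma AlternatingMap.eq_of_sub_mem {K V N : Type*} [Field K] [AddCommGroup V] [Module K V]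
    [AddCommGroup N] [Module K N] {m : ℕ} (ω : V [⋀^Fin m]→ₗ[K] N) (W : Submodule K V)
    (hω : ∀ v : Fin m → V, (∃ i, v i ∈ W) → ω v = 0) {v w : Fin m → V}
    (h : ∀ i, v i - w i ∈ W) : ω v = ω w := by
  have h1 : v = (v - w) + w := by simp
  rw [h1]
  refine (ω.toMultilinearMap.map_add_univ (v - w) w).trans ?_
  rw [Finset.sum_eq_single ∅]
  · simp
  · intro s _ hs
    obtain ⟨i, hi⟩ := Finset.nonempty_iff_ne_empty.2 hs
    exact hω _ ⟨i, by simpa [Finset.piecewise_eq_of_mem _ _ _ hi] using h i⟩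
  · simp

lemma finrank_Ann {n : ℕ} (μ : Set (Fin n → ℝ)) (m : ℕ) :
    finrank ℝ (Ann μ m) = (n - faceDim μ).choose m := by
  set W := Submodule.span ℝ μ with hW
  have hquot : finrank ℝ ((Fin n → ℝ) ⧸ W) = n - faceDim μ := by
    have := W.finrank_quotient_add_finrank
    rw [finrank_fin_fun] at this
    have h2 : faceDim μ = finrank ℝ W := rfl
    omega
  rw [← hquot, ← AlternatingMap.finrank_fin]
  obtain ⟨s, hs⟩ := W.mkQ.exists_rightInverse_of_surjective W.range_mkQ
  have hs' : ∀ x, W.mkQ (s x) = x := fun x => LinearMap.congr_fun hs x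
  refine LinearEquiv.finrank_eq
    { toFun := fun ω => ω.1.compLinearMap s
      map_add' := fun _ _ => rfl
      map_smul' := fun _ _ => rfl
      invFun := fun η => ⟨η.compLinearMap W.mkQ, ?_⟩
      left_inv := ?_
      right_inv := ?_ }
  · rintro v ⟨i, hi⟩
    exact η.map_coord_zero i ((Submodule.Quotient.mk_eq_zero W).2 hi)
  · rintro ⟨ω, hω⟩
    ext v
    refine ω.eq_of_sub_mem W hω fun i => ?_
    rw [← Submodule.Quotient.eq]
    exact hs' _
  · intro η
    ext v
    simp only [Submodule.mkQ_apply] at hs'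
    simp [hs']

end AlternatingForms

open scoped Classical in
/-- Let `σ` be a 4-dimensional full-dimensional strongly convex rational
polyhedral cone possessing a ray `τ₀` such that every facet of `σ` containing `τ₀` is
simplicial, and such that the rays of `σ` other than `τ₀` span `ℝ⁴`.  Let `f₁, …, f_k` be
the facets containing `τ₀` and `U = f₁ ∪ ⋯ ∪ f_k`.  Then the quotient complex `F⁰/F^k` of
the third Ishida complex, namely
`0 → Λ³M_ℝ → ⊕_{rays v ⊆ U} Λ²v^⊥ → ⊕_{2-faces e ⊆ U} Λ¹e^⊥ → ⊕_{f ∈ {f₁,…,f_k}} ℝ → 0`,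
has term dimensions `4, 3(k+1), 4k, k`, hence Euler characteristic `1`; since the first map
is injective, `H²(F⁰/F^k) ≠ 0`. -/
theorem stmt_16 (σ : Set (Fin 4 → ℝ))
    (hpoly : IsRatPolyhedralCone σ) (hsc : IsStronglyConvex σ) (hfull : faceDim σ = 4)
    (τ0 : Set (Fin 4 → ℝ)) (hτ0 : IsFaceOf σ τ0 ∧ faceDim τ0 = 1)
    -- every facet containing `τ₀` is simplicial:
    (hsimp : ∀ F : Set (Fin 4 → ℝ), IsFaceOf σ F → faceDim F = 3 → τ0 ⊆ F →
      IsSimplicialFace σ F)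
    -- the rays other than `τ₀` span `ℝ⁴`:
    (hspan : Submodule.span ℝ
      {x : Fin 4 → ℝ | ∃ r : Set (Fin 4 → ℝ),
        IsFaceOf σ r ∧ faceDim r = 1 ∧ r ≠ τ0 ∧ x ∈ r} = ⊤)
    -- `U` is the union of the facets containing `τ₀`, and `k` their number:
    (U : Set (Fin 4 → ℝ))
    (hU : U = {x | ∃ F : Set (Fin 4 → ℝ),
      (IsFaceOf σ F ∧ faceDim F = 3 ∧ τ0 ⊆ F) ∧ x ∈ F})
    [Fintype {F : Set (Fin 4 → ℝ) // IsFaceOf σ F ∧ faceDim F = 1 ∧ F ⊆ U}]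
    [Fintype {F : Set (Fin 4 → ℝ) // IsFaceOf σ F ∧ faceDim F = 2 ∧ F ⊆ U}]
    [Fintype {F : Set (Fin 4 → ℝ) // IsFaceOf σ F ∧ faceDim F = 3 ∧ τ0 ⊆ F}]
    (k : ℕ)
    (hk : k = Fintype.card {F : Set (Fin 4 → ℝ) // IsFaceOf σ F ∧ faceDim F = 3 ∧ τ0 ⊆ F})
    -- the contraction vectors `n_{μ,τ}`:
    (𝓃 : Set (Fin 4 → ℝ) → Set (Fin 4 → ℝ) → (Fin 4 → ℝ))
    (h𝓃 : ∀ μ τ : Set (Fin 4 → ℝ), IsFaceOf σ μ → IsFaceOf σ τ → μ ⊆ τ →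
      faceDim τ = faceDim μ + 1 →
      𝓃 μ τ ∈ Submodule.span ℝ τ ∧ 𝓃 μ τ ∉ Submodule.span ℝ μ ∧
        (∀ u : (Fin 4 → ℝ) →ₗ[ℝ] ℝ, (∀ x ∈ τ, 0 ≤ u x) → (∀ x ∈ μ, u x = 0) →
          0 ≤ u (𝓃 μ τ)))
    -- the differentials of the quotient complex `F⁰/F^k`:
    (d0 : ((Fin 4 → ℝ) [⋀^Fin (2+1)]→ₗ[ℝ] ℝ) →ₗ[ℝ]
      ((μ : {F : Set (Fin 4 → ℝ) // IsFaceOf σ F ∧ faceDim F = 1 ∧ F ⊆ U}) →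
        ↥(Ann μ.1 (1+1))))
    (d1 : (((μ : {F : Set (Fin 4 → ℝ) // IsFaceOf σ F ∧ faceDim F = 1 ∧ F ⊆ U}) →
        ↥(Ann μ.1 (1+1)))) →ₗ[ℝ]
      ((τ : {F : Set (Fin 4 → ℝ) // IsFaceOf σ F ∧ faceDim F = 2 ∧ F ⊆ U}) →
        ↥(Ann τ.1 (0+1))))
    (d2 : (((τ : {F : Set (Fin 4 → ℝ) // IsFaceOf σ F ∧ faceDim F = 2 ∧ F ⊆ U}) →
        ↥(Ann τ.1 (0+1)))) →ₗ[ℝ]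
      ((τ : {F : Set (Fin 4 → ℝ) // IsFaceOf σ F ∧ faceDim F = 3 ∧ τ0 ⊆ F}) →
        ↥(Ann τ.1 0)))
    (hd0 : ∀ ω (μ : {F : Set (Fin 4 → ℝ) // IsFaceOf σ F ∧ faceDim F = 1 ∧ F ⊆ U}),
      ((d0 ω μ : ↥(Ann μ.1 (1+1))) : (Fin 4 → ℝ) [⋀^Fin (1+1)]→ₗ[ℝ] ℝ) =
        ω.curryLeft (𝓃 {0} μ.1))
    (hd1 : ∀ x (τ : {F : Set (Fin 4 → ℝ) // IsFaceOf σ F ∧ faceDim F = 2 ∧ F ⊆ U}),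
      ((d1 x τ : ↥(Ann τ.1 (0+1))) : (Fin 4 → ℝ) [⋀^Fin (0+1)]→ₗ[ℝ] ℝ) =
        ∑ μ : {F : Set (Fin 4 → ℝ) // IsFaceOf σ F ∧ faceDim F = 1 ∧ F ⊆ U},
          if μ.1 ⊆ τ.1 then ((x μ : ↥(Ann μ.1 (1+1))) :
            (Fin 4 → ℝ) [⋀^Fin (1+1)]→ₗ[ℝ] ℝ).curryLeft (𝓃 μ.1 τ.1) else 0)
    (hd2 : ∀ x (τ : {F : Set (Fin 4 → ℝ) // IsFaceOf σ F ∧ faceDim F = 3 ∧ τ0 ⊆ F}),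
      ((d2 x τ : ↥(Ann τ.1 0)) : (Fin 4 → ℝ) [⋀^Fin 0]→ₗ[ℝ] ℝ) =
        ∑ μ : {F : Set (Fin 4 → ℝ) // IsFaceOf σ F ∧ faceDim F = 2 ∧ F ⊆ U},
          if μ.1 ⊆ τ.1 then ((x μ : ↥(Ann μ.1 (0+1))) :
            (Fin 4 → ℝ) [⋀^Fin (0+1)]→ₗ[ℝ] ℝ).curryLeft (𝓃 μ.1 τ.1) else 0)
    (hc1 : d1 ∘ₗ d0 = 0) (hc2 : d2 ∘ₗ d1 = 0) :
    -- the term dimensions are `4`, `3(k+1)`, `4k`, `k`: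
    Module.finrank ℝ ((Fin 4 → ℝ) [⋀^Fin (2+1)]→ₗ[ℝ] ℝ) = 4 ∧
    Module.finrank ℝ
      ((μ : {F : Set (Fin 4 → ℝ) // IsFaceOf σ F ∧ faceDim F = 1 ∧ F ⊆ U}) →
        ↥(Ann μ.1 (1+1))) = 3 * (k + 1) ∧
    Module.finrank ℝ
      ((τ : {F : Set (Fin 4 → ℝ) // IsFaceOf σ F ∧ faceDim F = 2 ∧ F ⊆ U}) →
        ↥(Ann τ.1 (0+1))) = 4 * k ∧
    Module.finrank ℝ
      ((τ : {F : Set (Fin 4 → ℝ) // IsFaceOf σ F ∧ faceDim F = 3 ∧ τ0 ⊆ F}) →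
        ↥(Ann τ.1 0)) = k ∧
    -- the first map is injective:
    Function.Injective d0 ∧
    -- and `H²(F⁰/F^k) ≠ 0`:
    ¬ (LinearMap.ker d2 ≤ LinearMap.range d1) := by
  let (μ : Set (Fin 4 → ℝ)) (m : ℕ) : AddCommGroup (Ann μ m) :=
    Submodule.addCommGroup (Ann μ m)
  obtain ⟨T, hσ⟩ := hpoly.exists_hull
  obtain ⟨hτ, hτd⟩ := hτ0
  obtain ⟨hR, hD⟩ := card_link hσ hsc hfull hτ hτd hsimp hU
    (R := Finset.univ.map (Function.Embedding.subtype fun F =>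
      IsFaceOf σ F ∧ faceDim F = 1 ∧ F ⊆ U))
    (D := Finset.univ.map (Function.Embedding.subtype fun F =>
      IsFaceOf σ F ∧ faceDim F = 2 ∧ F ⊆ U))
    (K := Finset.univ.map (Function.Embedding.subtype fun F =>
      IsFaceOf σ F ∧ faceDim F = 3 ∧ τ0 ⊆ F))
    (fun _ => by simp) (fun _ => by simp) (fun _ => by simp)
  rw [Finset.card_map, Finset.card_map, Finset.card_univ, Finset.card_univ, ← hk] at hR hD
  have hC0 : finrank ℝ ((Fin 4 → ℝ) [⋀^Fin (2+1)]→ₗ[ℝ] ℝ) = 4 := by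
    rw [AlternatingMap.finrank_fin, finrank_fin_fun]
    rfl
  have hC1 : finrank ℝ ((μ : {F : Set (Fin 4 → ℝ) // IsFaceOf σ F ∧ faceDim F = 1 ∧ F ⊆ U}) →
      ↥(Ann μ.1 (1+1))) = 3 * (k + 1) := by
    rw [finrank_pi_fintype, Finset.sum_congr rfl fun μ _ => (by
      rw [finrank_Ann, μ.2.2.1]; rfl : finrank ℝ (Ann μ.1 (1+1)) = 3), Finset.sum_const,
      Finset.card_univ, smul_eq_mul, mul_comm]
    exact congrArg _ hR
  have hC2 : finrank ℝ ((τ : {F : Set (Fin 4 → ℝ) // IsFaceOf σ F ∧ faceDim F = 2 ∧ F ⊆ U}) →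
      ↥(Ann τ.1 (0+1))) = 4 * k := by
    rw [finrank_pi_fintype, Finset.sum_congr rfl fun μ _ => (by
      rw [finrank_Ann, μ.2.2.1]; rfl : finrank ℝ (Ann μ.1 (0+1)) = 2), Finset.sum_const,
      Finset.card_univ, smul_eq_mul]
    exact (congrArg (· * 2) hD).trans (by ring)
  have hC3 : finrank ℝ ((τ : {F : Set (Fin 4 → ℝ) // IsFaceOf σ F ∧ faceDim F = 3 ∧ τ0 ⊆ F}) →
      ↥(Ann τ.1 0)) = k := by
    rw [finrank_pi_fintype, Finset.sum_congr rfl fun μ _ => (by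
      rw [finrank_Ann, Nat.choose_zero_right] : finrank ℝ (Ann μ.1 0) = 1), Finset.sum_const,
      Finset.card_univ, smul_eq_mul, mul_one, hk]
  have hinj : Function.Injective d0 := by
    rw [← LinearMap.ker_eq_bot, LinearMap.ker_eq_bot']
    intro ω hω
    have hker : ∀ r, IsFaceOf σ r → faceDim r = 1 → r ⊆ U →
        Submodule.span ℝ r ≤ LinearMap.ker ω.curryLeft := by
      intro r hr hrd hrU
      have h0 := isFaceOf_singleton_zero hσ hsc
      obtain ⟨hmem, hne, -⟩ := h𝓃 {0} r h0 hr (Set.singleton_subset_iff.2 (hr.zero_mem hσ))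
        (by rw [hrd, faceDim_singleton_zero])
      rw [Submodule.span_zero_singleton, Submodule.mem_bot] at hne
      have hv : ω.curryLeft (𝓃 {0} r) = 0 := by
        rw [← hd0 ω ⟨r, hr, hrd, hrU⟩, hω]
        rfl
      intro x hx
      obtain ⟨c, hc⟩ := (finrank_eq_one_iff_of_nonzero' (⟨𝓃 {0} r, hmem⟩ : Submodule.span ℝ r)
        (fun h => hne (congrArg Subtype.val h))).1 hrd ⟨x, hx⟩
      have hc : c • 𝓃 {0} r = x := congrArg Subtype.val hc
      rw [LinearMap.mem_ker, ← hc, map_smul, hv, smul_zero]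
    have htop : Submodule.span ℝ σ = ⊤ :=
      Submodule.eq_top_of_finrank_eq (by rw [finrank_fin_fun]; exact hfull)
    have hle := span_rays_of_link hσ hsc hfull hτ hτd hU hker
    rw [htop, top_le_iff, LinearMap.ker_eq_top] at hle
    ext v
    rw [← Matrix.cons_head_tail v]
    exact congrArg (fun f => f (Matrix.vecHead v) (Matrix.vecTail v)) hle
  refine ⟨hC0, hC1, hC2, hC3, hinj, fun hle => ?_⟩
  have h1 := d0.finrank_range_add_finrank_ker
  have h2 := d1.finrank_range_add_finrank_ker
  have h3 := d2.finrank_range_add_finrank_ker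
  rw [LinearMap.ker_eq_bot.2 hinj, finrank_bot, hC0] at h1
  rw [hC1] at h2
  rw [hC2] at h3
  have h4 := Submodule.finrank_mono (LinearMap.range_le_ker_iff.2 hc1)
  have h5 := Submodule.finrank_mono hle
  have h6 := (Submodule.finrank_le (LinearMap.range d2)).trans_eq hC3
  omega
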